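/- Let r ≥ 5 be an integer, let â_j := j/r for 0 ≤ j ≤ r and â_j := 1 for j > r, let N := ⌈3·log₂ r⌉, and let 0 ≤ k ≤ r. Then for any univariate real polynomial Q such that Q(x) = ∫_{−1}^{1} T_k(y)·S_r^{(â)}(x,y)² dμ(y) for all x ∈ ℝ, one has ‖p_{r,N}^{(â)}·Q − T_k‖_{1,cheb} ≤ (45k²·(log₂ r + 1) + 4)/r². -/

import Mathlib

open Polynomial MeasureTheory

/-- The k-th Chebyshev polynomial of the first kind over ℝ. -/
noncomputable def chebT (k : ℕ) : Polynomial ℝ := Polynomial.Chebyshev.T ℝ (k : ℤ)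

/-- The Chebyshev 1-norm of a univariate real polynomial: the sum of the absolute
values of the coefficients in the (unique) expansion in the Chebyshev basis. -/
noncomputable def cheb1Norm (p : Polynomial ℝ) : ℝ :=
  sInf {s : ℝ | ∃ c : ℕ →₀ ℝ,
    p = c.sum (fun j coef => Polynomial.C coef * chebT j) ∧ s = c.sum (fun _ coef => |coef|)}

/-- The Chebyshev probability measure on `[-1,1]`, `dμ(y) = dy/(π √(1-y²))`. -/
noncomputable def chebMeasure : Measure ℝ :=
  (volume.restrict (Set.Icc (-1 : ℝ) 1)).withDensity
    (fun y => ENNReal.ofReal (1 / (Real.pi * Real.sqrt (1 - y ^ 2))))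

/-- The kernel `S_r^{(a)}(x,y) = 1 + 2∑_{j=1}^r (1-a_j) T_j(x) T_j(y)`. -/
noncomputable def Sker (r : ℕ) (a : ℕ → ℝ) (x y : ℝ) : ℝ :=
  1 + 2 * ∑ j ∈ Finset.Icc 1 r, (1 - a j) * (chebT j).eval x * (chebT j).eval y

/-- `M_r^{(a)}` as a polynomial, `M_r^{(a)} = 1 + 2∑_{j=1}^r (1-a_j)² T_j²`. -/
noncomputable def MPoly (r : ℕ) (a : ℕ → ℝ) : Polynomial ℝ :=
  1 + Polynomial.C 2 * ∑ j ∈ Finset.Icc 1 r, Polynomial.C ((1 - a j) ^ 2) * (chebT j) ^ 2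

/-- `C = 1 + 2∑_{j=1}^r (1-a_j)²`. -/
noncomputable def Cval (r : ℕ) (a : ℕ → ℝ) : ℝ := 1 + 2 * ∑ j ∈ Finset.Icc 1 r, (1 - a j) ^ 2

/-- The polynomial `p_{r,N}^{(a)} = (1/C) ∑_{m=0}^{N} (1 - M_r^{(a)}/C)^m`. -/
noncomputable def pPoly (r : ℕ) (a : ℕ → ℝ) (N : ℕ) : Polynomial ℝ :=
  Polynomial.C (1 / Cval r a) *
    ∑ m ∈ Finset.range (N + 1), ((1 : Polynomial ℝ) - Polynomial.C (1 / Cval r a) * MPoly r a) ^ m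

/-- The Fejér weights `â_j = j/r` for `j ≤ r` and `â_j = 1` for `j > r`. -/
noncomputable def fejerWeights (r : ℕ) : ℕ → ℝ := fun j => if j ≤ r then (j : ℝ) / r else 1

/-- The polynomial `p` has a Chebyshev expansion with coefficients of absolute sum at most `B`. -/
def ChebBound (p : Polynomial ℝ) (B : ℝ) : Prop :=
  ∃ c : ℕ →₀ ℝ, p = c.sum (fun j coef => Polynomial.C coef * chebT j) ∧
    c.sum (fun _ coef => |coef|) ≤ B

theorem ChebBound.cheb1Norm_le {p : Polynomial ℝ} {B : ℝ} (h : ChebBound p B) :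
    cheb1Norm p ≤ B := by
  obtain ⟨c, hp, hc⟩ := h
  refine le_trans (csInf_le ?_ ⟨c, hp, rfl⟩) hc
  refine ⟨0, ?_⟩
  rintro s ⟨c, -, rfl⟩
  exact Finset.sum_nonneg fun _ _ => abs_nonneg _

theorem ChebBound.nonneg {p : Polynomial ℝ} {B : ℝ} (h : ChebBound p B) : 0 ≤ B := by
  obtain ⟨c, -, hc⟩ := h
  exact (Finset.sum_nonneg fun _ _ => abs_nonneg _).trans hc

theorem ChebBound.mono {p : Polynomial ℝ} {B B' : ℝ} (h : ChebBound p B) (hB : B ≤ B') :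
    ChebBound p B' := by
  obtain ⟨c, hp, hc⟩ := h
  exact ⟨c, hp, hc.trans hB⟩

theorem chebBound_zero : ChebBound 0 0 := ⟨0, by simp, by simp⟩

theorem chebBound_T (n : ℤ) : ChebBound (Chebyshev.T ℝ n) 1 :=
  ⟨Finsupp.single n.natAbs 1, by
    rw [Finsupp.sum_single_index (by simp), chebT, Chebyshev.T_natAbs, C_1, one_mul], by simp⟩

theorem chebBound_one : ChebBound 1 1 := by
  simpa using chebBound_T 0

theorem ChebBound.add {p q : Polynomial ℝ} {A B : ℝ} (hp : ChebBound p A) (hq : ChebBound q B) :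
    ChebBound (p + q) (A + B) := by
  obtain ⟨c, rfl, hc⟩ := hp
  obtain ⟨d, rfl, hd⟩ := hq
  refine ⟨c + d, ?_, ?_⟩
  · rw [Finsupp.sum_add_index'] <;> simp [add_mul]
  · refine le_trans ?_ (add_le_add hc hd)
    classical
    rw [Finsupp.sum_of_support_subset (c + d) Finsupp.support_add _ (by simp),
      Finsupp.sum_of_support_subset c Finset.subset_union_left _ (by simp),
      Finsupp.sum_of_support_subset d (Finset.subset_union_right (s₁ := c.support)) _ (by simp),
      ← Finset.sum_add_distrib]
    exact Finset.sum_le_sum fun i _ => abs_add_le _ _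

theorem ChebBound.C_mul {p : Polynomial ℝ} {B : ℝ} (hp : ChebBound p B) (a : ℝ) :
    ChebBound (C a * p) (|a| * B) := by
  obtain ⟨c, rfl, hc⟩ := hp
  refine ⟨a • c, ?_, ?_⟩
  · rw [Finsupp.sum_smul_index (by simp), Finsupp.sum, Finsupp.sum, Finset.mul_sum]
    simp [mul_assoc]
  · rw [Finsupp.sum_smul_index (by simp), Finsupp.sum]
    simp only [abs_mul]
    rw [← Finset.mul_sum]
    exact mul_le_mul_of_nonneg_left hc (abs_nonneg a)

theorem ChebBound.neg {p : Polynomial ℝ} {B : ℝ} (hp : ChebBound p B) : ChebBound (-p) B := by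
  simpa using hp.C_mul (-1)

theorem chebBound_sum {ι : Type*} (s : Finset ι) {f : ι → Polynomial ℝ} {B : ι → ℝ}
    (h : ∀ i ∈ s, ChebBound (f i) (B i)) : ChebBound (∑ i ∈ s, f i) (∑ i ∈ s, B i) := by
  classical
  induction s using Finset.induction_on with
  | empty => simpa using chebBound_zero
  | insert a s ha ih =>
    rw [Finset.sum_insert ha, Finset.sum_insert ha]
    exact (h a (Finset.mem_insert_self a s)).add
      (ih fun i hi => h i (Finset.mem_insert_of_mem hi))

theorem T_mul_T_eq (m n : ℤ) : Chebyshev.T ℝ m * Chebyshev.T ℝ n =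
    C (1 / 2) * (Chebyshev.T ℝ (m + n) + Chebyshev.T ℝ (m - n)) := by
  have h2 : (C (1 / 2) : Polynomial ℝ) * 2 = 1 := by
    rw [← C_ofNat, ← C_mul]
    norm_num
  rw [← Chebyshev.T_mul_T]
  linear_combination (-(Chebyshev.T ℝ m * Chebyshev.T ℝ n)) * h2

theorem chebBound_T_mul_T (m n : ℤ) : ChebBound (Chebyshev.T ℝ m * Chebyshev.T ℝ n) 1 := by
  rw [T_mul_T_eq]
  exact (((chebBound_T _).add (chebBound_T _)).C_mul _).mono (by norm_num [abs_of_pos])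

theorem ChebBound.mul {p q : Polynomial ℝ} {A B : ℝ} (hp : ChebBound p A) (hq : ChebBound q B) :
    ChebBound (p * q) (A * B) := by
  have hA := hp.nonneg
  obtain ⟨c, rfl, hc⟩ := hp
  obtain ⟨d, rfl, hd⟩ := hq
  rw [Finsupp.sum, Finsupp.sum, Finset.sum_mul_sum]
  refine ChebBound.mono (B := ∑ i ∈ c.support, ∑ j ∈ d.support, |c i| * |d j|)
    (chebBound_sum _ fun i _ => chebBound_sum _ fun j _ => ?_) ?_
  · convert (chebBound_T_mul_T i j).C_mul (c i * d j) using 1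
    · simp only [chebT, Polynomial.C_mul]; ring
    · rw [abs_mul, mul_one]
  · rw [← Finset.sum_mul_sum]
    exact mul_le_mul hc hd (Finset.sum_nonneg fun _ _ => abs_nonneg _) hA

theorem ChebBound.pow_le_one {p : Polynomial ℝ} (hp : ChebBound p 1) (n : ℕ) :
    ChebBound (p ^ n) 1 := by
  induction n with
  | zero => simpa using chebBound_one
  | succ n ih => simpa [pow_succ] using ih.mul hp

theorem integral_chebMeasure (f : ℝ → ℝ) :
    ∫ x, f x ∂chebMeasure = Real.pi⁻¹ * ∫ x, f x ∂Chebyshev.measureT := by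
  rw [Chebyshev.integral_measureT, intervalIntegral.integral_of_le (by norm_num), chebMeasure,
    integral_withDensity_eq_integral_toReal_smul (by fun_prop)
      (Filter.Eventually.of_forall fun _ => ENNReal.ofReal_lt_top),
    integral_Icc_eq_integral_Ioc, ← integral_const_mul]
  congr 1
  ext x
  rw [ENNReal.toReal_ofReal (by positivity), Real.sqrt_inv, smul_eq_mul, one_div, mul_inv]
  ring

/-- Integration of polynomials against the Chebyshev probability measure. -/
noncomputable def chebIntegral : Polynomial ℝ →ₗ[ℝ] ℝ where
  toFun p := ∫ x, p.eval x ∂chebMeasure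
  map_add' p q := by
    simp only [integral_chebMeasure, eval_add]
    rw [integral_add (Chebyshev.integrable_measureT (by fun_prop))
      (Chebyshev.integrable_measureT (by fun_prop))]
    ring
  map_smul' a p := by
    simp only [eval_smul, smul_eq_mul, integral_const_mul, RingHom.id_apply]

theorem chebIntegral_apply (p : Polynomial ℝ) :
    chebIntegral p = ∫ x, p.eval x ∂chebMeasure := rfl

theorem chebIntegral_C_mul (a : ℝ) (p : Polynomial ℝ) :
    chebIntegral (C a * p) = a * chebIntegral p := by
  rw [← smul_eq_C_mul, map_smul, smul_eq_mul]

theorem chebIntegral_T (n : ℤ) : chebIntegral (Chebyshev.T ℝ n) = if n = 0 then 1 else 0 := by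
  rw [chebIntegral_apply, integral_chebMeasure]
  split_ifs with h
  · rw [h, Chebyshev.integral_eval_T_real_measureT_zero]
    exact inv_mul_cancel₀ Real.pi_ne_zero
  · rw [Chebyshev.integral_eval_T_real_measureT_of_ne_zero h, mul_zero]

theorem chebIntegral_T_mul_T (m n : ℤ) :
    chebIntegral (Chebyshev.T ℝ m * Chebyshev.T ℝ n) =
      ((if m = -n then 1 else 0) + if m = n then 1 else 0) / 2 := by
  rw [T_mul_T_eq, chebIntegral_C_mul, map_add, chebIntegral_T, chebIntegral_T]
  simp only [sub_eq_zero, add_eq_zero_iff_eq_neg]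
  ring

theorem chebIntegral_mono {p q : Polynomial ℝ}
    (h : ∀ x ∈ Set.Icc (-1 : ℝ) 1, p.eval x ≤ q.eval x) : chebIntegral p ≤ chebIntegral q := by
  rw [chebIntegral_apply, chebIntegral_apply, integral_chebMeasure, integral_chebMeasure,
    Chebyshev.integral_measureT_eq_integral_cos, Chebyshev.integral_measureT_eq_integral_cos]
  refine mul_le_mul_of_nonneg_left ?_ (by positivity)
  refine intervalIntegral.integral_mono_on Real.pi_nonneg
    (Continuous.intervalIntegrable (by fun_prop) _ _)
    (Continuous.intervalIntegrable (by fun_prop) _ _) fun θ _ => h _ (Real.cos_mem_Icc θ)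

theorem exists_chebT_expansion {p : Polynomial ℝ} {D : ℕ} (hp : p.natDegree ≤ D) :
    ∃ c : ℕ → ℝ, p = ∑ j ∈ Finset.range (D + 1), C (c j) * chebT j := by
  have hspan := (Chebyshev.chebyshevTsequence ℝ).span_degreeLE (m := D) fun i _ =>
    (leadingCoeff_ne_zero.2 (Polynomial.Sequence.ne_zero _ i)).isUnit
  have hmem : p ∈ degreeLE ℝ (D : WithBot ℕ) := mem_degreeLE.2 (natDegree_le_iff_degree_le.1 hp)
  have himage : (Chebyshev.chebyshevTsequence ℝ : ℕ → Polynomial ℝ) '' Set.Iic D =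
      chebT '' (Finset.range (D + 1) : Set ℕ) := by
    rw [Finset.coe_range, Set.Iio_add_one_eq_Iic]
    rfl
  rw [← hspan, himage, Submodule.mem_span_image_finset_iff_exists_fun] at hmem
  obtain ⟨c, hc⟩ := hmem
  refine ⟨fun j => if h : j ∈ Finset.range (D + 1) then c ⟨j, h⟩ else 0, ?_⟩
  rw [← hc, ← Finset.sum_coe_sort (Finset.range (D + 1))]
  refine Finset.sum_congr rfl fun j _ => ?_
  simp only [j.2, dif_pos, smul_eq_C_mul]


/-- A polynomial bounded by `B` on `[-1, 1]` has Chebyshev norm at most `√(2(D + 1)) B`. -/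
theorem chebBound_of_abs_le {p : Polynomial ℝ} {D : ℕ} {B : ℝ} (hp : p.natDegree ≤ D)
    (hB : 0 ≤ B) (h : ∀ x ∈ Set.Icc (-1 : ℝ) 1, |p.eval x| ≤ B) :
    ChebBound p (√(2 * (D + 1)) * B) := by
  obtain ⟨c, hc⟩ := exists_chebT_expansion hp
  have hle : chebIntegral (p * p) ≤ B ^ 2 := by
    have : chebIntegral (C (B ^ 2) * 1) = B ^ 2 := by
      rw [chebIntegral_C_mul, ← Chebyshev.T_zero ℝ, chebIntegral_T]
      simp
    rw [← this]
    refine chebIntegral_mono fun x hx => ?_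
    simpa [← sq] using sq_le_sq' (abs_le.1 (h x hx)).1 (abs_le.1 (h x hx)).2
  have hge : (∑ j ∈ Finset.range (D + 1), c j ^ 2) / 2 ≤ chebIntegral (p * p) := by
    rw [hc, Finset.sum_mul_sum, map_sum, Finset.sum_div]
    refine Finset.sum_le_sum fun i hi => ?_
    have hterm : ∀ j, chebIntegral (C (c i) * chebT i * (C (c j) * chebT j)) =
        c i * c j * (((if (i : ℤ) = -(j : ℤ) then 1 else 0) + if (i : ℤ) = j then 1 else 0) / 2) := by
      intro j
      rw [← chebIntegral_T_mul_T, ← chebIntegral_C_mul, chebT, chebT, C_mul]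
      congr 1
      ring
    rw [map_sum, Finset.sum_eq_single_of_mem i hi]
    · rw [hterm]
      rw [if_pos rfl]
      split_ifs <;> nlinarith [sq_nonneg (c i)]
    · intro j _ hj
      rw [hterm, if_neg (by omega), if_neg (by omega)]
      simp
  refine ChebBound.mono (B := ∑ j ∈ Finset.range (D + 1), |c j|) ?_ ?_
  · rw [hc]
    refine chebBound_sum _ fun j _ => ?_
    simpa [chebT] using (chebBound_T j).C_mul (c j)
  · refine le_of_sq_le_sq ?_ (by positivity)
    have := sq_sum_le_card_mul_sum_sq (s := Finset.range (D + 1)) (f := fun j => |c j|)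
    simp only [Finset.card_range, sq_abs] at this
    rw [mul_pow, Real.sq_sqrt (by positivity)]
    refine this.trans ?_
    push_cast
    nlinarith

theorem sum_Icc_neg_of_even {R : Type*} [CommRing R] {f : ℤ → R} (hf : ∀ i, f (-i) = f i)
    (r : ℕ) : ∑ i ∈ Finset.Icc (-r : ℤ) r, f i = f 0 + 2 * ∑ j ∈ Finset.Icc 1 r, f j := by
  induction r with
  | zero => simp
  | succ r ih =>
    push_cast
    rw [Finset.sum_Icc_succ_eq_add_endpoints, ih, Finset.sum_Icc_succ_top (by omega), hf]
    push_cast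
    ring

/-- The Dirichlet kernel: `(1 - z) (1 + 2∑_{j=1}^n T_j(z)) = T_n(z) - T_{n+1}(z)`. -/
theorem one_sub_mul_dirichlet (z : ℝ) (n : ℕ) :
    (1 - z) * (1 + 2 * ∑ j ∈ Finset.Icc 1 n, (chebT j).eval z) =
      (chebT n).eval z - (chebT (n + 1)).eval z := by
  induction n with
  | zero => simp [chebT]
  | succ n ih =>
    have hrec : (chebT (n + 1 + 1)).eval z =
        2 * z * (chebT (n + 1)).eval z - (chebT n).eval z := by
      simp [chebT, add_assoc]
    rw [Finset.sum_Icc_succ_top (by omega), hrec]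
    linear_combination ih

theorem fejer_succ (t : ℕ → ℝ) (n : ℕ) :
    ((n + 1 : ℕ) : ℝ) + 2 * ∑ j ∈ Finset.Icc 1 (n + 1), (((n + 1 : ℕ) : ℝ) - j) * t j =
      n + 2 * ∑ j ∈ Finset.Icc 1 n, ((n : ℝ) - j) * t j + (1 + 2 * ∑ j ∈ Finset.Icc 1 n, t j) := by
  have : ∑ j ∈ Finset.Icc 1 n, (((n + 1 : ℕ) : ℝ) - j) * t j =
      ∑ j ∈ Finset.Icc 1 n, ((n : ℝ) - j) * t j + ∑ j ∈ Finset.Icc 1 n, t j := by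
    rw [← Finset.sum_add_distrib]
    refine Finset.sum_congr rfl fun j _ => ?_
    push_cast
    ring
  rw [Finset.sum_Icc_succ_top (by omega), this]
  push_cast
  ring

/-- The Fejér kernel: `(1 - z) (n + 2∑_{j=1}^n (n-j) T_j(z)) = 1 - T_n(z)`. -/
theorem one_sub_mul_fejer (z : ℝ) (n : ℕ) :
    (1 - z) * (n + 2 * ∑ j ∈ Finset.Icc 1 n, ((n : ℝ) - j) * (chebT j).eval z) =
      1 - (chebT n).eval z := by
  induction n with
  | zero => simp [chebT]
  | succ n ih =>
    rw [fejer_succ fun j => (chebT j).eval z]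
    linear_combination ih + one_sub_mul_dirichlet z n

theorem abs_eval_chebT_le_one (n : ℕ) {z : ℝ} (hz : z ∈ Set.Icc (-1 : ℝ) 1) :
    |(chebT n).eval z| ≤ 1 :=
  Chebyshev.abs_eval_T_real_le_one n (abs_le.2 hz)

theorem fejer_nonneg {z : ℝ} (hz : z ∈ Set.Icc (-1 : ℝ) 1) (n : ℕ) :
    0 ≤ n + 2 * ∑ j ∈ Finset.Icc 1 n, ((n : ℝ) - j) * (chebT j).eval z := by
  rcases hz.2.eq_or_lt with rfl | hlt
  · have : 0 ≤ ∑ j ∈ Finset.Icc 1 n, ((n : ℝ) - j) * (chebT j).eval 1 := by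
      refine Finset.sum_nonneg fun j hj => ?_
      simp [chebT, (Finset.mem_Icc.1 hj).2]
    positivity
  · have h1 := one_sub_mul_fejer z n
    have h2 := (abs_le.1 (abs_eval_chebT_le_one n hz)).2
    exact nonneg_of_mul_nonneg_right (by rw [h1]; linarith) (sub_pos.2 hlt)

theorem squared_weights_nonneg {z : ℝ} (hz : z ∈ Set.Icc (-1 : ℝ) 1) (n : ℕ) :
    0 ≤ (n : ℝ) ^ 2 + 2 * ∑ j ∈ Finset.Icc 1 n, ((n : ℝ) - j) ^ 2 * (chebT j).eval z := by
  induction n with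
  | zero => simp
  | succ n ih =>
    have h1 := fejer_nonneg hz n
    have h2 := fejer_nonneg hz (n + 1)
    have hsum : ∑ j ∈ Finset.Icc 1 (n + 1), (((n + 1 : ℕ) : ℝ) - j) ^ 2 * (chebT j).eval z =
        ∑ j ∈ Finset.Icc 1 n, ((n : ℝ) - j) ^ 2 * (chebT j).eval z +
        ∑ j ∈ Finset.Icc 1 n, ((n : ℝ) - j) * (chebT j).eval z +
        ∑ j ∈ Finset.Icc 1 (n + 1), (((n + 1 : ℕ) : ℝ) - j) * (chebT j).eval z := by
      rw [Finset.sum_Icc_succ_top (by omega), Finset.sum_Icc_succ_top (by omega), sub_self,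
        ← Finset.sum_add_distrib]
      simp only [ne_eq, OfNat.ofNat_ne_zero, not_false_eq_true, zero_pow, zero_mul, add_zero]
      rw [← Finset.sum_add_distrib]
      refine Finset.sum_congr rfl fun j _ => ?_
      push_cast
      ring
    rw [hsum]
    push_cast at h2 ⊢
    nlinarith

/-- The Fejér weights `1 - |i| / r` on the integers, cut off at `|i| = r`. -/
noncomputable def fejerW (r : ℕ) (i : ℤ) : ℝ := 1 - fejerWeights r i.natAbs

theorem fejerW_neg (r : ℕ) (i : ℤ) : fejerW r (-i) = fejerW r i := by
  simp [fejerW]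

theorem fejerW_natCast (r j : ℕ) : fejerW r j = 1 - fejerWeights r j := by
  simp [fejerW]

theorem fejerW_zero (r : ℕ) : fejerW r 0 = 1 := by
  simp [fejerW, fejerWeights]

theorem fejerW_eq_max {r : ℕ} (hr : 0 < r) (i : ℤ) : fejerW r i = max 0 (1 - |(i : ℝ)| / r) := by
  have hr' : (0 : ℝ) < r := by exact_mod_cast hr
  have habs : ((i.natAbs : ℕ) : ℝ) = |(i : ℝ)| := by
    rw [Nat.cast_natAbs, Int.cast_abs]
  rw [fejerW, fejerWeights]
  split_ifs with h
  · have h' : |(i : ℝ)| ≤ r := by rw [← habs]; exact_mod_cast h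
    rw [habs, max_eq_right (sub_nonneg.2 ((div_le_one hr').2 h'))]
  · have h' : (r : ℝ) ≤ |(i : ℝ)| := by rw [← habs]; exact_mod_cast (not_le.1 h).le
    rw [max_eq_left (sub_nonpos.2 ((one_le_div hr').2 h')), sub_self]

theorem fejerW_eq_zero {r : ℕ} {i : ℤ} (h : r < i.natAbs) : fejerW r i = 0 := by
  simp [fejerW, fejerWeights, not_le.2 h]

theorem abs_fejerW_sub_le {r : ℕ} (hr : 0 < r) (i j : ℤ) :
    |fejerW r i - fejerW r j| ≤ |(i : ℝ) - j| / r := by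
  have hr' : (0 : ℝ) < r := by exact_mod_cast hr
  rw [fejerW_eq_max hr, fejerW_eq_max hr, max_comm 0, max_comm 0]
  refine (abs_max_sub_max_le_abs (1 - |(i : ℝ)| / r) (1 - |(j : ℝ)| / r) 0).trans ?_
  rw [show 1 - |(i : ℝ)| / r - (1 - |(j : ℝ)| / r) = (|(j : ℝ)| - |(i : ℝ)|) / r by ring,
    abs_div, abs_of_pos hr', abs_sub_comm (i : ℝ)]
  exact div_le_div_of_nonneg_right (abs_abs_sub_abs_le (j : ℝ) (i : ℝ)) hr'.le

theorem Cval_eq (r : ℕ) :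
    Cval r (fejerWeights r) = ∑ i ∈ Finset.Icc (-r : ℤ) r, fejerW r i ^ 2 := by
  rw [sum_Icc_neg_of_even fun i => by rw [fejerW_neg], Cval, fejerW_zero]
  simp only [fejerW_natCast, one_pow]

theorem MPoly_eq (r : ℕ) : MPoly r (fejerWeights r) =
    ∑ i ∈ Finset.Icc (-r : ℤ) r, C (fejerW r i ^ 2) * Chebyshev.T ℝ i ^ 2 := by
  rw [sum_Icc_neg_of_even fun i => by rw [fejerW_neg, Chebyshev.T_neg], MPoly, fejerW_zero]
  simp [fejerW_natCast, chebT, ← C_ofNat]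

theorem Sker_eq (r : ℕ) (x y : ℝ) : Sker r (fejerWeights r) x y =
    ∑ i ∈ Finset.Icc (-r : ℤ) r,
      fejerW r i * (Chebyshev.T ℝ i).eval x * (Chebyshev.T ℝ i).eval y := by
  rw [sum_Icc_neg_of_even fun i => by rw [fejerW_neg, Chebyshev.T_neg], Sker, fejerW_zero]
  simp [fejerW_natCast, chebT]

theorem sum_Icc_sq_eq (r : ℕ) (n : ℕ) : 3 * ∑ j ∈ Finset.Icc 1 n, ((r : ℝ) - j) ^ 2 =
    3 * n * r ^ 2 - 3 * r * n * (n + 1) + n * (n + 1) * (2 * n + 1) / 2 := by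
  induction n with
  | zero => simp
  | succ n ih =>
    rw [Finset.sum_Icc_succ_top (by omega), mul_add, ih]
    push_cast
    ring

theorem Cval_lower_bound {r : ℕ} (hr : 0 < r) : 2 * r / 3 ≤ Cval r (fejerWeights r) := by
  have hr' : (0 : ℝ) < r := by exact_mod_cast hr
  have hsum : ∑ j ∈ Finset.Icc 1 r, (1 - fejerWeights r j) ^ 2 =
      (∑ j ∈ Finset.Icc 1 r, ((r : ℝ) - j) ^ 2) / r ^ 2 := by
    rw [Finset.sum_div]
    refine Finset.sum_congr rfl fun j hj => ?_
    rw [fejerWeights, if_pos (Finset.mem_Icc.1 hj).2]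
    field_simp
  have h3 := sum_Icc_sq_eq r r
  rw [Cval, hsum, ← sub_nonneg]
  have : 1 + 2 * ((∑ j ∈ Finset.Icc 1 r, ((r : ℝ) - j) ^ 2) / r ^ 2) - 2 * r / 3 =
      1 / (3 * r) := by
    field_simp
    linear_combination 2 * h3
  rw [this]
  positivity

/-- The kernel `S_r(x, ·)` with Fejér weights as a polynomial. -/
noncomputable def fejerSPoly (r : ℕ) (x : ℝ) : Polynomial ℝ :=
  ∑ i ∈ Finset.Icc (-r : ℤ) r, C (fejerW r i * (Chebyshev.T ℝ i).eval x) * Chebyshev.T ℝ i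

theorem eval_fejerSPoly (r : ℕ) (x y : ℝ) :
    (fejerSPoly r x).eval y = Sker r (fejerWeights r) x y := by
  simp [fejerSPoly, Sker_eq, eval_finsetSum]

theorem chebIntegral_fejerSPoly_mul_T (r : ℕ) (x : ℝ) (n : ℤ) :
    chebIntegral (fejerSPoly r x * Chebyshev.T ℝ n) =
      fejerW r n * (Chebyshev.T ℝ n).eval x := by
  have hterm : ∀ i, chebIntegral
      (C (fejerW r i * (Chebyshev.T ℝ i).eval x) * Chebyshev.T ℝ i * Chebyshev.T ℝ n) =
      (if i = -n then fejerW r i * (Chebyshev.T ℝ i).eval x / 2 else 0) +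
        if i = n then fejerW r i * (Chebyshev.T ℝ i).eval x / 2 else 0 := by
    intro i
    rw [mul_assoc, chebIntegral_C_mul, chebIntegral_T_mul_T]
    split_ifs <;> ring
  simp only [fejerSPoly, Finset.sum_mul, map_sum, hterm, Finset.sum_add_distrib,
    Finset.sum_ite_eq', fejerW_neg, Chebyshev.T_neg, Finset.mem_Icc]
  by_cases hn : n.natAbs ≤ r
  · rw [if_pos (by omega), if_pos (by omega)]
    ring
  · rw [if_neg (by omega), if_neg (by omega), fejerW_eq_zero (by omega)]
    ring

theorem sum_Icc_mul_shift (r : ℕ) (k : ℤ) {f u : ℤ → ℝ} (hf : ∀ i, f (-i) = f i)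
    (hu : ∀ i, u (-i) = u i) :
    ∑ j ∈ Finset.Icc (-r : ℤ) r, f j * ((u (j + k) + u (j - k)) / 2) =
      ∑ j ∈ Finset.Icc (-r : ℤ) r, f j * u (j + k) := by
  have hrefl : ∑ j ∈ Finset.Icc (-r : ℤ) r, f j * u (j - k) =
      ∑ j ∈ Finset.Icc (-r : ℤ) r, f j * u (j + k) := by
    refine Finset.sum_nbij' (fun j => -j) (fun j => -j) ?_ ?_ ?_ ?_ ?_
    · intro j hj; simp only [Finset.mem_Icc] at hj ⊢; omega
    · intro j hj; simp only [Finset.mem_Icc] at hj ⊢; omega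
    · intro j _; ring
    · intro j _; ring
    · intro j _
      rw [hf, show -j + k = -(j - k) by ring, hu]
  have : ∀ j, f j * ((u (j + k) + u (j - k)) / 2) =
      f j * u (j + k) / 2 + f j * u (j - k) / 2 := fun j => by ring
  simp only [this]
  rw [Finset.sum_add_distrib, ← Finset.sum_div, ← Finset.sum_div, hrefl]
  ring

theorem eval_T_mul_eval_T (x : ℝ) (m n : ℤ) :
    (Chebyshev.T ℝ m).eval x * (Chebyshev.T ℝ n).eval x =
      ((Chebyshev.T ℝ (m + n)).eval x + (Chebyshev.T ℝ (m - n)).eval x) / 2 := by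
  rw [← eval_mul, T_mul_T_eq]
  simp
  ring

theorem integral_T_mul_Sker_sq (r : ℕ) (k : ℕ) (x : ℝ) :
    ∫ y, (chebT k).eval y * (Sker r (fejerWeights r) x y) ^ 2 ∂chebMeasure =
      ∑ j ∈ Finset.Icc (-r : ℤ) r, fejerW r j * fejerW r (j + k) *
        ((Chebyshev.T ℝ j).eval x * (Chebyshev.T ℝ (j + k)).eval x) := by
  have h1 : ∫ y, (chebT k).eval y * (Sker r (fejerWeights r) x y) ^ 2 ∂chebMeasure =
      chebIntegral (fejerSPoly r x * (fejerSPoly r x * chebT k)) := by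
    rw [chebIntegral_apply]
    congr 1
    ext y
    rw [eval_mul, eval_mul, eval_fejerSPoly]
    ring
  have h2 : fejerSPoly r x * (fejerSPoly r x * chebT k) =
      ∑ j ∈ Finset.Icc (-r : ℤ) r, C (fejerW r j * (Chebyshev.T ℝ j).eval x) *
        (C (1 / 2) * (fejerSPoly r x * Chebyshev.T ℝ (j + k) +
          fejerSPoly r x * Chebyshev.T ℝ (j - k))) := by
    conv_lhs => rw [mul_left_comm]
    conv_lhs => enter [1]; rw [fejerSPoly]
    rw [Finset.sum_mul]
    refine Finset.sum_congr rfl fun j _ => ?_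
    have := T_mul_T_eq j k
    rw [chebT]
    linear_combination C (fejerW r j * (Chebyshev.T ℝ j).eval x) * fejerSPoly r x * this
  rw [h1, h2, map_sum]
  simp only [chebIntegral_C_mul, map_add, chebIntegral_fejerSPoly_mul_T]
  have h3 := sum_Icc_mul_shift r k (f := fun j => fejerW r j * (Chebyshev.T ℝ j).eval x)
    (u := fun j => fejerW r j * (Chebyshev.T ℝ j).eval x)
    (fun i => by rw [fejerW_neg, Chebyshev.T_neg]) (fun i => by rw [fejerW_neg, Chebyshev.T_neg])
  refine Eq.trans (Finset.sum_congr rfl fun j _ => ?_)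
    (h3.trans (Finset.sum_congr rfl fun j _ => ?_)) <;> ring

theorem eval_MPoly_mul_chebT (r : ℕ) (k : ℕ) (x : ℝ) :
    (MPoly r (fejerWeights r) * chebT k).eval x =
      ∑ j ∈ Finset.Icc (-r : ℤ) r, fejerW r j ^ 2 *
        ((Chebyshev.T ℝ j).eval x * (Chebyshev.T ℝ (j + k)).eval x) := by
  have h3 := sum_Icc_mul_shift r k (f := fun j => fejerW r j ^ 2 * (Chebyshev.T ℝ j).eval x)
    (u := fun j => (Chebyshev.T ℝ j).eval x)
    (fun i => by rw [fejerW_neg, Chebyshev.T_neg]) (fun i => by rw [Chebyshev.T_neg])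
  rw [MPoly_eq, eval_mul, eval_finsetSum, Finset.sum_mul]
  refine Eq.trans (Finset.sum_congr rfl fun j _ => ?_)
    (h3.trans (Finset.sum_congr rfl fun j _ => ?_))
  · rw [← eval_T_mul_eval_T, chebT]
    simp
    ring
  · ring

theorem sub_MPoly_mul_chebT_eq {r k : ℕ} {Q : Polynomial ℝ}
    (hQ : ∀ x : ℝ, Q.eval x =
      ∫ y, (chebT k).eval y * (Sker r (fejerWeights r) x y) ^ 2 ∂chebMeasure) :
    Q - MPoly r (fejerWeights r) * chebT k =
      ∑ j ∈ Finset.Icc (-r - k : ℤ) r, C (-(fejerW r j - fejerW r (j + k)) ^ 2 / 2) *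
        (Chebyshev.T ℝ j * Chebyshev.T ℝ (j + k)) := by
  refine Polynomial.funext fun x => ?_
  set t : ℤ → ℝ := fun j => (Chebyshev.T ℝ j).eval x with ht
  have hsub : Finset.Icc (-r : ℤ) r ⊆ Finset.Icc (-r - k : ℤ) r :=
    Finset.Icc_subset_Icc_left (by omega)
  have hzero : ∀ j ∈ Finset.Icc (-r - k : ℤ) r, j ∉ Finset.Icc (-r : ℤ) r → fejerW r j = 0 := by
    intro j hj hj'
    simp only [Finset.mem_Icc] at hj hj'
    exact fejerW_eq_zero (by omega)
  have hrefl : ∑ j ∈ Finset.Icc (-r - k : ℤ) r, fejerW r (j + k) ^ 2 * (t j * t (j + k)) =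
      ∑ j ∈ Finset.Icc (-r - k : ℤ) r, fejerW r j ^ 2 * (t j * t (j + k)) := by
    refine Finset.sum_nbij' (fun j => -(j + k)) (fun j => -(j + k)) ?_ ?_ ?_ ?_ ?_
    · intro j hj; simp only [Finset.mem_Icc] at hj ⊢; omega
    · intro j hj; simp only [Finset.mem_Icc] at hj ⊢; omega
    · intro j _; ring
    · intro j _; ring
    · intro j _
      have e : -(j + k : ℤ) + k = -j := by ring
      simp only [ht]
      rw [e, fejerW_neg, Chebyshev.T_neg, Chebyshev.T_neg]
      ring
  rw [eval_sub, hQ, integral_T_mul_Sker_sq, eval_MPoly_mul_chebT, eval_finsetSum,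
    Finset.sum_subset hsub fun j hj hj' => by rw [hzero j hj hj']; ring,
    Finset.sum_subset hsub fun j hj hj' => by rw [hzero j hj hj']; ring]
  have hsplit : ∀ j : ℤ, (C (-(fejerW r j - fejerW r (j + k)) ^ 2 / 2) *
        (Chebyshev.T ℝ j * Chebyshev.T ℝ (j + k))).eval x =
      fejerW r j * fejerW r (j + k) * (t j * t (j + k)) - fejerW r j ^ 2 * (t j * t (j + k)) / 2 -
        fejerW r (j + k) ^ 2 * (t j * t (j + k)) / 2 := by
    intro j
    simp only [eval_mul, eval_C, ht]
    ring
  simp only [hsplit, Finset.sum_sub_distrib]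
  rw [← Finset.sum_div, ← Finset.sum_div, hrefl]
  ring

theorem chebBound_sub_MPoly_mul_chebT {r k : ℕ} (hr : 0 < r) {Q : Polynomial ℝ}
    (hQ : ∀ x : ℝ, Q.eval x =
      ∫ y, (chebT k).eval y * (Sker r (fejerWeights r) x y) ^ 2 ∂chebMeasure) :
    ChebBound (Q - MPoly r (fejerWeights r) * chebT k)
      ((2 * r + k + 1) * ((k / r) ^ 2 / 2)) := by
  rw [sub_MPoly_mul_chebT_eq hQ]
  refine (chebBound_sum (B := fun _ => ((k : ℝ) / r) ^ 2 / 2) _ fun j _ =>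
    ((chebBound_T_mul_T j (j + k)).C_mul _).mono ?_).mono ?_
  · have h := abs_fejerW_sub_le hr j (j + k)
    have e : |(j : ℝ) - ((j + k : ℤ) : ℝ)| = k := by
      push_cast
      rw [sub_add_cancel_left, abs_neg, Nat.abs_cast]
    rw [e] at h
    rw [mul_one, abs_div, abs_neg, abs_of_nonneg (sq_nonneg _), abs_two, ← sq_abs]
    gcongr
  · rw [Finset.sum_const, nsmul_eq_mul, Int.card_Icc]
    have : ((r : ℤ) + 1 - (-r - k)).toNat = 2 * r + k + 1 := by omega
    rw [this]
    push_cast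
    rfl

/-- The normalised remainder `1 - M_r / C`. -/
noncomputable def fejerRemainder (r : ℕ) : Polynomial ℝ :=
  1 - C (1 / Cval r (fejerWeights r)) * MPoly r (fejerWeights r)

theorem fejerRemainder_eq {r : ℕ} (hr : 0 < r) : fejerRemainder r =
    C (1 / 2) * (1 - C (1 / Cval r (fejerWeights r)) *
      ∑ i ∈ Finset.Icc (-r : ℤ) r, C (fejerW r i ^ 2) * Chebyshev.T ℝ (i + i)) := by
  have hC : 0 < Cval r (fejerWeights r) :=
    lt_of_lt_of_le (by positivity) (Cval_lower_bound hr)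
  have hM : MPoly r (fejerWeights r) = C (1 / 2) * (C (Cval r (fejerWeights r)) +
      ∑ i ∈ Finset.Icc (-r : ℤ) r, C (fejerW r i ^ 2) * Chebyshev.T ℝ (i + i)) := by
    rw [MPoly_eq, Cval_eq, map_sum, ← Finset.sum_add_distrib, Finset.mul_sum]
    refine Finset.sum_congr rfl fun i _ => ?_
    rw [sq (Chebyshev.T ℝ i), T_mul_T_eq, sub_self, Chebyshev.T_zero]
    ring
  have hinv : C (1 / Cval r (fejerWeights r)) * C (Cval r (fejerWeights r)) = 1 := by
    rw [← C_mul, one_div_mul_cancel hC.ne', C_1]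
  have hhalf : (C (1 / 2) : Polynomial ℝ) * 2 = 1 := by
    rw [← C_ofNat, ← C_mul]
    norm_num
  rw [fejerRemainder, hM]
  linear_combination (-C (1 / 2) : Polynomial ℝ) * hinv - hhalf

theorem chebBound_fejerRemainder {r : ℕ} (hr : 0 < r) : ChebBound (fejerRemainder r) 1 := by
  have hC : 0 < Cval r (fejerWeights r) :=
    lt_of_lt_of_le (by positivity) (Cval_lower_bound hr)
  have hsum : ChebBound
      (∑ i ∈ Finset.Icc (-r : ℤ) r, C (fejerW r i ^ 2) * Chebyshev.T ℝ (i + i))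
      (Cval r (fejerWeights r)) := by
    rw [Cval_eq]
    exact chebBound_sum _ fun i _ =>
      ((chebBound_T (i + i)).C_mul _).mono (by rw [mul_one, abs_of_nonneg (sq_nonneg _)])
  rw [fejerRemainder_eq hr, sub_eq_add_neg]
  refine ((chebBound_one.add (hsum.C_mul _).neg).C_mul _).mono ?_
  rw [abs_of_pos (one_div_pos.2 hC), one_div_mul_cancel hC.ne']
  norm_num [abs_of_pos]

theorem abs_eval_fejerRemainder_le {r : ℕ} (hr : 0 < r) {x : ℝ} (hx : x ∈ Set.Icc (-1 : ℝ) 1) :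
    |(fejerRemainder r).eval x| ≤ 1 / 2 := by
  have hC : 0 < Cval r (fejerWeights r) :=
    lt_of_lt_of_le (by positivity) (Cval_lower_bound hr)
  have hr' : (0 : ℝ) < r := by exact_mod_cast hr
  set K : ℝ := ∑ i ∈ Finset.Icc (-r : ℤ) r, fejerW r i ^ 2 * (Chebyshev.T ℝ (i + i)).eval x with hK
  have heval : (fejerRemainder r).eval x = 1 / 2 * (1 - 1 / Cval r (fejerWeights r) * K) := by
    simp [fejerRemainder_eq hr, eval_finsetSum, hK]
  have hKle : K ≤ Cval r (fejerWeights r) := by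
    rw [Cval_eq]
    refine Finset.sum_le_sum fun i _ => mul_le_of_le_one_right (sq_nonneg _) ?_
    exact (abs_le.1 (Chebyshev.abs_eval_T_real_le_one _ (abs_le.2 hx))).2
  have hKnonneg : 0 ≤ K := by
    have hz : (chebT 2).eval x ∈ Set.Icc (-1 : ℝ) 1 := abs_le.1 (abs_eval_chebT_le_one 2 hx)
    have hKeq : K = (r ^ 2 + 2 * ∑ j ∈ Finset.Icc 1 r,
        ((r : ℝ) - j) ^ 2 * (chebT j).eval ((chebT 2).eval x)) / r ^ 2 := by
      rw [hK, sum_Icc_neg_of_even fun i => by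
        rw [fejerW_neg, ← neg_add, Chebyshev.T_neg], fejerW_zero, add_div,
        div_self (by positivity), mul_div_assoc, Finset.sum_div]
      simp only [one_pow, add_zero, Chebyshev.T_zero, eval_one, mul_one]
      congr 2
      refine Finset.sum_congr rfl fun j hj => ?_
      rw [← mul_two, Chebyshev.T_mul, eval_comp, fejerW_natCast, fejerWeights,
        if_pos (Finset.mem_Icc.1 hj).2, chebT, chebT]
      push_cast
      field_simp
    rw [hKeq]
    exact div_nonneg (squared_weights_nonneg hz r) (by positivity)
  have h1 : 1 / Cval r (fejerWeights r) * K ≤ 1 := by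
    rw [one_div_mul_eq_div]
    exact (div_le_one hC).2 hKle
  have h0 : 0 ≤ 1 / Cval r (fejerWeights r) * K := by positivity
  rw [heval, abs_le]
  constructor <;> linarith

theorem natDegree_fejerRemainder_le (r : ℕ) : (fejerRemainder r).natDegree ≤ 2 * r := by
  have hM : (MPoly r (fejerWeights r)).natDegree ≤ 2 * r := by
    rw [MPoly_eq]
    refine natDegree_sum_le_of_forall_le _ _ fun i hi => ?_
    refine (natDegree_C_mul_le _ _).trans (natDegree_pow_le.trans ?_)
    rw [Chebyshev.natDegree_T]
    rw [Finset.mem_Icc] at hi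
    omega
  refine (natDegree_sub_le _ _).trans (max_le (by simp) ?_)
  exact (natDegree_C_mul_le _ _).trans hM

theorem chebBound_fejerRemainder_pow {r : ℕ} (hr : 0 < r) (n : ℕ) :
    ChebBound (fejerRemainder r ^ n) (√(2 * ((2 * r * n : ℕ) + 1)) * (1 / 2) ^ n) := by
  refine chebBound_of_abs_le ?_ (by positivity) fun x hx => ?_
  · refine natDegree_pow_le.trans ?_
    rw [mul_comm]
    exact Nat.mul_le_mul_right _ (natDegree_fejerRemainder_le r)
  · rw [eval_pow, abs_pow]
    exact pow_le_pow_left₀ (abs_nonneg _) (abs_eval_fejerRemainder_le hr hx) n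

theorem chebBound_pPoly {r : ℕ} (hr : 0 < r) (N : ℕ) :
    ChebBound (pPoly r (fejerWeights r) N) (3 / (2 * r) * (N + 1)) := by
  have hr' : (0 : ℝ) < r := by exact_mod_cast hr
  have hlow := Cval_lower_bound hr
  have hC : 0 < Cval r (fejerWeights r) := lt_of_lt_of_le (by positivity) hlow
  have hsum := chebBound_sum (Finset.range (N + 1)) fun m _ =>
    (chebBound_fejerRemainder hr).pow_le_one m
  refine (hsum.C_mul (1 / Cval r (fejerWeights r))).mono ?_
  rw [abs_of_pos (one_div_pos.2 hC)]
  simp only [Finset.sum_const, Finset.card_range, nsmul_eq_mul, mul_one]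
  push_cast
  refine mul_le_mul_of_nonneg_right ?_ (by positivity)
  rw [div_le_div_iff₀ hC (by positivity)]
  linarith

theorem pPoly_mul_MPoly (r N : ℕ) : pPoly r (fejerWeights r) N * MPoly r (fejerWeights r) =
    1 - fejerRemainder r ^ (N + 1) := by
  rw [← mul_neg_geom_sum, pPoly, fejerRemainder]
  ring

/-- error bound for the squared Fejér kernel with `N = ⌈3 log₂ r⌉`. -/
theorem cheb1Norm_squared_fejer_error (r : ℕ) (hr : 5 ≤ r) (k : ℕ) (hk : k ≤ r)
    (N : ℕ) (hN : N = ⌈3 * Real.logb 2 r⌉₊)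
    (Q : Polynomial ℝ)
    (hQ : ∀ x : ℝ, Q.eval x =
      ∫ y, (chebT k).eval y * (Sker r (fejerWeights r) x y) ^ 2 ∂chebMeasure) :
    cheb1Norm (pPoly r (fejerWeights r) N * Q - chebT k) ≤
      (45 * (k : ℝ) ^ 2 * (Real.logb 2 r + 1) + 4) / (r : ℝ) ^ 2 := by
  have hr0 : 0 < r := by omega
  have hr5 : (5 : ℝ) ≤ r := by exact_mod_cast hr
  have hrpos : (0 : ℝ) < r := by linarith
  have hkr : (k : ℝ) ≤ r := by exact_mod_cast hk
  set L := Real.logb 2 r with hL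
  have hL0 : 0 ≤ L := Real.logb_nonneg (by norm_num) (by linarith)
  have hLr : L ≤ r := by
    rw [hL, Real.logb_le_iff_le_rpow (by norm_num) hrpos, Real.rpow_natCast]
    exact_mod_cast Nat.lt_two_pow_self.le
  have hNlow : 3 * L ≤ N := hN ▸ Nat.le_ceil _
  have hNup : (N : ℝ) < 3 * L + 1 := hN ▸ Nat.ceil_lt_add_one (by positivity)
  have hpow : (1 / 2 : ℝ) ^ (N + 1) ≤ 1 / (2 * r ^ 3) := by
    have h2 : (r : ℝ) ^ 3 ≤ 2 ^ N := by
      calc (r : ℝ) ^ 3 = ((2 : ℝ) ^ L) ^ 3 := by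
            rw [hL, Real.rpow_logb (by norm_num) (by norm_num) hrpos]
        _ = (2 : ℝ) ^ (3 * L) := by
            rw [← Real.rpow_natCast, ← Real.rpow_mul (by norm_num)]
            norm_num [mul_comm]
        _ ≤ (2 : ℝ) ^ (N : ℝ) := Real.rpow_le_rpow_of_exponent_le (by norm_num) hNlow
        _ = 2 ^ N := Real.rpow_natCast _ _
    rw [one_div_pow]
    refine one_div_le_one_div_of_le (by positivity) ?_
    rw [pow_succ 2 N]
    linarith
  have hsqrt : √(2 * ((2 * r * (N + 1) : ℕ) + 1)) ≤ 8 * r := by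
    rw [Real.sqrt_le_left (by positivity)]
    push_cast
    nlinarith
  have htail : ChebBound (-(fejerRemainder r ^ (N + 1) * chebT k)) (4 / r ^ 2) := by
    refine ((chebBound_fejerRemainder_pow hr0 (N + 1)).mul (chebBound_T k)).neg.mono ?_
    rw [mul_one]
    refine (mul_le_mul hsqrt hpow (by positivity) (by positivity)).trans_eq ?_
    field_simp
    norm_num
  have hmain := (chebBound_pPoly hr0 N).mul (chebBound_sub_MPoly_mul_chebT hr0 hQ)
  have hsplit : pPoly r (fejerWeights r) N * Q - chebT k =
      pPoly r (fejerWeights r) N * (Q - MPoly r (fejerWeights r) * chebT k) +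
        -(fejerRemainder r ^ (N + 1) * chebT k) := by
    linear_combination chebT k * pPoly_mul_MPoly r N
  rw [hsplit]
  refine (hmain.add htail).cheb1Norm_le.trans ?_
  rw [add_div]
  gcongr
  calc 3 / (2 * (r : ℝ)) * (N + 1) * ((2 * r + k + 1) * ((k / r) ^ 2 / 2))
      ≤ 3 / (2 * (r : ℝ)) * (3 * L + 2) * ((4 * r) * ((k / r) ^ 2 / 2)) := by
        gcongr ?_ * ?_ * (?_ * _)
        · linarith
        · linarith
    _ = 3 * k ^ 2 * (3 * L + 2) / r ^ 2 := by
        field_simp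
        norm_num
    _ ≤ 45 * k ^ 2 * (L + 1) / r ^ 2 := by
        refine div_le_div_of_nonneg_right ?_ (by positivity)
        nlinarith [mul_nonneg (sq_nonneg (k : ℝ)) hL0, sq_nonneg (k : ℝ)]
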